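/- Let A₁, A₂ : ℝ² → ℝ³ be twice continuously differentiable, set F_{1 2} = ∂₁A₂ − ∂₂A₁ + A₁ × A₂, and suppose the static pure Yang–Mills equations D_iF_{i j} = ∂_iF_{i j} + A_i × F_{i j} = 0 (j = 1,2, with F_{j i} = −F_{i j} and F_{i i} = 0) hold on ℝ², and that ∫_{ℝ²} |F_{1 2}|² dx < ∞. Then F_{1 2} ≡ 0 on ℝ². -/

import Mathlib

/-!
Triviality of finite-energy solutions of the static pure SU(2) Yang–Mills
equations in two space dimensions: D_iF_{ij} = 0 with ∫ |F₁₂|² < ∞ forces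
F₁₂ ≡ 0.
-/

open MeasureTheory

noncomputable section

/-- The plane ℝ². -/
abbrev Plane : Type := EuclideanSpace ℝ (Fin 2)

/-- Euclidean ℝ³. -/
abbrev V3 : Type := EuclideanSpace ℝ (Fin 3)

/-- The vector cross product on ℝ³. -/
def cross (a b : V3) : V3 :=
  (WithLp.equiv 2 (Fin 3 → ℝ)).symm
    ![a 1 * b 2 - a 2 * b 1, a 2 * b 0 - a 0 * b 2, a 0 * b 1 - a 1 * b 0]

/-- Partial derivative of an ℝ³-valued field in the `i`-th coordinate direction. -/
def pd (i : Fin 2) (f : Plane → V3) (x : Plane) : V3 :=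
  fderiv ℝ f x (EuclideanSpace.single i 1)

/-- The Yang–Mills curvature F_{ij} = ∂ᵢA_j − ∂_jAᵢ + Aᵢ × A_j
(antisymmetric in i, j, with F_{ii} = 0). -/
def curv (A : Fin 2 → Plane → V3) (i j : Fin 2) (x : Plane) : V3 :=
  pd i (A j) x - pd j (A i) x + cross (A i x) (A j x)

theorem cross_self_eq_zero (a : V3) : cross a a = 0 := by
  ext k
  fin_cases k <;> simp [cross] <;> ring

theorem cross_zero (a : V3) : cross a 0 = 0 := by
  ext k
  fin_cases k <;> simp [cross]

theorem cross_neg (a b : V3) : cross a (-b) = -cross a b := by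
  ext k
  fin_cases k <;> simp [cross] <;> ring

theorem cross_eq_neg_cross (a b : V3) : cross a b = -cross b a := by
  ext k
  fin_cases k <;> simp [cross] <;> ring

theorem inner_cross_self (a b : V3) : inner ℝ b (cross a b) = 0 := by
  simp [cross, PiLp.inner_apply, Fin.sum_univ_three]
  ring

theorem pd_neg (i : Fin 2) (f : Plane → V3) (x : Plane) :
    pd i (fun y => -f y) x = -pd i f x := by
  simp [pd, fderiv_fun_neg]

theorem Differentiable.cross {f g : Plane → V3} (hf : Differentiable ℝ f)
    (hg : Differentiable ℝ g) : Differentiable ℝ fun x => cross (f x) (g x) := by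
  rw [differentiable_euclidean] at hf hg ⊢
  intro k
  fin_cases k
  · exact ((hf 1).mul (hg 2)).sub ((hf 2).mul (hg 1))
  · exact ((hf 2).mul (hg 0)).sub ((hf 0).mul (hg 2))
  · exact ((hf 0).mul (hg 1)).sub ((hf 1).mul (hg 0))

theorem ContDiff.differentiable_pd {f : Plane → V3} (hf : ContDiff ℝ 2 f) (i : Fin 2) :
    Differentiable ℝ (pd i f) := by
  have h : ContDiff ℝ 1 (fderiv ℝ f) := hf.fderiv_right (by norm_num)
  exact (h.differentiable one_ne_zero).clm_apply (differentiable_const _)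

theorem differentiable_curv {A : Fin 2 → Plane → V3} (hA : ∀ i, ContDiff ℝ 2 (A i))
    (i j : Fin 2) : Differentiable ℝ (curv A i j) :=
  (((hA j).differentiable_pd i).sub ((hA i).differentiable_pd j)).add
    (((hA i).differentiable two_ne_zero).cross ((hA j).differentiable two_ne_zero))

theorem curv_self (A : Fin 2 → Plane → V3) (i : Fin 2) (x : Plane) : curv A i i x = 0 := by
  simp [curv, cross_self_eq_zero]

theorem curv_antisymm (A : Fin 2 → Plane → V3) (i j : Fin 2) (x : Plane) :
    curv A i j x = -curv A j i x := by
  rw [curv, curv, cross_eq_neg_cross (A i x)]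
  abel

/-- In two dimensions the Yang–Mills equations say that `F₁₂` is covariantly constant. -/
theorem pd_curv_add_cross_eq_zero {A : Fin 2 → Plane → V3}
    (hYM : ∀ j x, ∑ i, (pd i (fun y => curv A i j y) x
        + cross (A i x) (curv A i j x)) = 0) (i : Fin 2) (x : Plane) :
    pd i (curv A 0 1) x + cross (A i x) (curv A 0 1 x) = 0 := by
  have pd_zero (i : Fin 2) : pd i (fun _ => (0 : V3)) x = 0 := by simp [pd]
  fin_cases i
  · simpa [Fin.sum_univ_two, curv_self, pd_zero, cross_zero] using hYM 1 x
  · have h := hYM 0 x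
    simp only [Fin.sum_univ_two, curv_self, pd_zero, cross_zero, curv_antisymm A 1 0,
      pd_neg, cross_neg, add_zero, zero_add, ← neg_add, neg_eq_zero] at h
    exact h

/-- A covariantly constant field has constant norm, since `A × F` is orthogonal to `F`. -/
theorem norm_sq_const_of_covariantly_const {A : Fin 2 → Plane → V3} {F : Plane → V3}
    (hF : Differentiable ℝ F) (h : ∀ i x, pd i F x + cross (A i x) (F x) = 0) (x y : Plane) :
    ‖F x‖ ^ 2 = ‖F y‖ ^ 2 := by
  refine is_const_of_fderiv_eq_zero (𝕜 := ℝ) (f := fun x => ‖F x‖ ^ 2) (hF.norm_sq ℝ)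
    (fun z => ?_) x y
  rw [((hF z).hasFDerivAt.norm_sq).fderiv]
  refine ContinuousLinearMap.coe_injective
    ((EuclideanSpace.basisFun (Fin 2) ℝ).toBasis.ext fun i => ?_)
  have hi : fderiv ℝ F z (EuclideanSpace.single i 1) = -cross (A i z) (F z) :=
    eq_neg_of_add_eq_zero_left (h i z)
  simp [hi, inner_cross_self]

theorem pure_yang_mills_trivial
    (A : Fin 2 → Plane → V3) (hA : ∀ i, ContDiff ℝ 2 (A i))
    -- the static pure Yang–Mills equations D_iF_{ij} = ∂ᵢF_{ij} + Aᵢ × F_{ij} = 0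
    (hYM : ∀ j x, ∑ i, (pd i (fun y => curv A i j y) x
        + cross (A i x) (curv A i j x)) = 0)
    (hfin : Integrable (fun x => ‖curv A 0 1 x‖ ^ 2)) :
    ∀ x, curv A 0 1 x = 0 := by
  intro x
  have hconst : (fun y => ‖curv A 0 1 y‖ ^ 2) = fun _ => ‖curv A 0 1 x‖ ^ 2 :=
    funext fun y => norm_sq_const_of_covariantly_const (differentiable_curv hA 0 1)
      (pd_curv_add_cross_eq_zero hYM) y x
  rw [hconst, integrable_const_iff] at hfin
  rcases hfin with h | h
  · simpa using h
  · exact absurd h.measure_univ_lt_top (by simp)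

end
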